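/- arXiv:1311.0581 — 6 statements merged into one kernel-verified Lean document; each statement's English description precedes it below -/
import Mathlib

section
/- Let (P, x, y) be a d-dimensional all-but-simple spindle whose length (the minimal length of a path from x to y) is at least d + 1. Then every path from x to y in P revisits some facet: for every path u_0 = x, u_1, …, u_k = y there exist a facet F of P and indices i < j < l with u_i ∈ F, u_j ∉ F and u_l ∈ F. -/
/-!
STATEMENT 0: A d-dimensional all-but-simple spindle (P, x, y) whose length
(minimal length of a path from x to y) is at least d + 1 is a counterexample to
the nonrevisiting conjecture: every path from x to y revisits some facet.
-/

noncomputable section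

/-- `ℝ^d`. -/
abbrev Euc (d : ℕ) := EuclideanSpace ℝ (Fin d)

/-- A face of `P` is `P` itself or an exposed face of `P`: the set of points of `P`
maximizing some linear functional. -/
def IsFaceOf {d : ℕ} (P F : Set (Euc d)) : Prop :=
  F = P ∨ ∃ l : Euc d →ₗ[ℝ] ℝ, F = {x ∈ P | ∀ y ∈ P, l y ≤ l x}

/-- A vertex of `P` is a point `v` such that `{v}` is a face of `P`. -/
def IsVertexOf {d : ℕ} (P : Set (Euc d)) (v : Euc d) : Prop :=
  IsFaceOf P {v}

/-- A facet of the `d`-dimensional polytope `P` is a face whose affine span has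
dimension `d - 1`. -/
def IsFacetOf {d : ℕ} (P F : Set (Euc d)) : Prop :=
  IsFaceOf P F ∧ Module.finrank ℝ (affineSpan ℝ F).direction = d - 1

/-- An edge of `P` is a face whose affine span has dimension `1`. -/
def IsEdgeOf {d : ℕ} (P F : Set (Euc d)) : Prop :=
  IsFaceOf P F ∧ Module.finrank ℝ (affineSpan ℝ F).direction = 1

/-- Two vertices are adjacent if the closed segment joining them is an edge of `P`. -/
def AdjacentIn {d : ℕ} (P : Set (Euc d)) (u v : Euc d) : Prop :=
  IsEdgeOf P (segment ℝ u v)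

/-- A path from `x` to `y` of length `k`: a sequence of vertices
`u 0 = x, …, u k = y` with consecutive vertices adjacent. -/
def IsPathIn {d : ℕ} (P : Set (Euc d)) (x y : Euc d) (k : ℕ)
    (u : Fin (k + 1) → Euc d) : Prop :=
  u 0 = x ∧ u (Fin.last k) = y ∧ (∀ i, IsVertexOf P (u i)) ∧
    ∀ i : Fin k, AdjacentIn P (u i.castSucc) (u i.succ)

/-- The path `u` revisits the facet `F` if there are indices `i < j < l` with
`u i ∈ F`, `u j ∉ F` and `u l ∈ F`. -/
def PathRevisits {d k : ℕ} (u : Fin (k + 1) → Euc d) (F : Set (Euc d)) : Prop :=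
  ∃ i j l : Fin (k + 1), i < j ∧ j < l ∧ u i ∈ F ∧ u j ∉ F ∧ u l ∈ F

/-- A polytope is the convex hull of a nonempty finite set of points. -/
def IsPolytope {d : ℕ} (P : Set (Euc d)) : Prop :=
  ∃ S : Finset (Euc d), S.Nonempty ∧ P = convexHull ℝ (S : Set (Euc d))

/-- A vertex of a `d`-dimensional polytope is simple if it is incident to exactly
`d` facets. -/
def IsSimpleVertexOf {d : ℕ} (P : Set (Euc d)) (v : Euc d) : Prop :=
  IsVertexOf P v ∧ {F : Set (Euc d) | IsFacetOf P F ∧ v ∈ F}.ncard = d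

/-- A spindle `(P, x, y)`: a full-dimensional polytope `P ⊆ ℝ^d` with two distinct
vertices `x` and `y` such that every facet of `P` is incident to `x` or to `y`. -/
def IsSpindle {d : ℕ} (P : Set (Euc d)) (x y : Euc d) : Prop :=
  IsPolytope P ∧ affineSpan ℝ P = ⊤ ∧ IsVertexOf P x ∧ IsVertexOf P y ∧ x ≠ y ∧
    ∀ F, IsFacetOf P F → x ∈ F ∨ y ∈ F

/-- Linear functionals maximized over the polytope at `w`, strictly smaller at `v`,
whose tight generators span at least dimension `n`. -/
theorem exists_tight_functional {d : ℕ} (S : Finset (Euc d)) (v w : Euc d)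
    (hspan : affineSpan ℝ (convexHull ℝ (S : Set (Euc d))) = ⊤)
    (hw : w ∈ convexHull ℝ (S : Set (Euc d)))
    (l₀ : Euc d →ₗ[ℝ] ℝ) (h₀ : ∀ s ∈ S, l₀ s ≤ l₀ w) (h₀v : l₀ v < l₀ w) :
    ∀ n : ℕ, n ≤ d - 1 → ∃ l : Euc d →ₗ[ℝ] ℝ, (∀ s ∈ S, l s ≤ l w) ∧ l v < l w ∧
      n ≤ Module.finrank ℝ
        (Submodule.span ℝ {z : Euc d | ∃ s ∈ S, l s = l w ∧ z = s - w}) := by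
  intro n
  induction n with
  | zero => intro _; exact ⟨l₀, h₀, h₀v, Nat.zero_le _⟩
  | succ n ih =>
    intro hn
    obtain ⟨l, hl, hlv, hr⟩ := ih (by omega)
    set T := {z : Euc d | ∃ s ∈ S, l s = l w ∧ z = s - w} with hT
    by_cases hbig : n + 1 ≤ Module.finrank ℝ (Submodule.span ℝ T)
    · exact ⟨l, hl, hlv, hbig⟩
    have hU : Submodule.span ℝ T ⊔ Submodule.span ℝ {v - w} < ⊤ := by
      rw [lt_top_iff_ne_top]
      intro htop
      have h1 := Submodule.finrank_add_le_finrank_add_finrank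
        (Submodule.span ℝ T) (Submodule.span ℝ {v - w})
      rw [htop, finrank_top, finrank_euclideanSpace_fin] at h1
      have h2 := finrank_span_le_card (R := ℝ) ({v - w} : Set (Euc d))
      simp at h2
      omega
    obtain ⟨m₀, hm₀, hm₀U⟩ := Submodule.exists_le_ker_of_lt_top _ hU
    have hex : ∃ s ∈ S, m₀ s ≠ m₀ w := by
      by_contra! hcon
      have hP : convexHull ℝ (S : Set (Euc d)) ⊆ {z | m₀ z = m₀ w} :=
        convexHull_min (fun s hs => hcon s hs)
          (convex_hyperplane m₀.isLinear (m₀ w))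
      have hdir : vectorSpan ℝ (convexHull ℝ (S : Set (Euc d))) = ⊤ := by
        rw [← direction_affineSpan, hspan, AffineSubspace.direction_top]
      rw [vectorSpan_eq_span_vsub_set_right ℝ hw] at hdir
      apply hm₀
      rw [← LinearMap.ker_eq_top, eq_top_iff, ← hdir, Submodule.span_le]
      rintro _ ⟨p, hp, rfl⟩
      have := hP hp
      simp only [Set.mem_ofPred_eq] at this
      simp [this]
    have hm : ∃ m : Euc d →ₗ[ℝ] ℝ, (∃ s ∈ S, 0 < m s - m w) ∧
        (∀ z ∈ T, m z = 0) ∧ m v = m w := by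
      have hmT : ∀ z ∈ T, m₀ z = 0 := fun z hz =>
        hm₀U (Submodule.mem_sup_left (Submodule.subset_span hz))
      have hmv : m₀ v = m₀ w := by
        have : m₀ (v - w) = 0 :=
          hm₀U (Submodule.mem_sup_right (Submodule.mem_span_singleton_self _))
        rw [map_sub] at this
        linarith
      obtain ⟨s, hs, hne⟩ := hex
      rcases lt_or_gt_of_ne hne with h | h
      · refine ⟨-m₀, ⟨s, hs, ?_⟩, ?_, ?_⟩
        · simp only [LinearMap.neg_apply]; linarith
        · intro z hz; simp [hmT z hz]
        · simp [hmv]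
      · exact ⟨m₀, ⟨s, hs, by linarith⟩, hmT, hmv⟩
    obtain ⟨m, ⟨s₀, hs₀, hs₀m⟩, hmT, hmv⟩ := hm
    obtain ⟨q, hq, hqmin⟩ := Finset.exists_min_image (S.filter fun s => 0 < m s - m w)
      (fun s => (l w - l s) / (m s - m w)) ⟨s₀, Finset.mem_filter.2 ⟨hs₀, hs₀m⟩⟩
    rw [Finset.mem_filter] at hq
    obtain ⟨hqS, hqm⟩ := hq
    set t := (l w - l q) / (m q - m w) with ht
    have ht0 : 0 ≤ t := div_nonneg (by linarith [hl q hqS]) hqm.le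
    have htq : t * (m q - m w) = l w - l q := div_mul_cancel₀ _ hqm.ne'
    refine ⟨l + t • m, ?_, ?_, ?_⟩
    · intro s hs
      simp only [LinearMap.add_apply, LinearMap.smul_apply, smul_eq_mul]
      by_cases hsm : 0 < m s - m w
      · have := hqmin s (by simp only [Finset.mem_filter]; exact ⟨hs, hsm⟩)
        rw [le_div_iff₀ hsm] at this
        change t * _ ≤ _ at this
        linarith
      · have := mul_nonneg ht0 (sub_nonneg.2 (not_lt.1 hsm) : 0 ≤ 0 - (m s - m w))
        linarith [hl s hs]
    · simp only [LinearMap.add_apply, LinearMap.smul_apply, smul_eq_mul, hmv]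
      linarith
    · set T' := {z : Euc d | ∃ s ∈ S, (l + t • m) s = (l + t • m) w ∧ z = s - w} with hT'
      have hlt : Submodule.span ℝ T < Submodule.span ℝ T' := by
        refine lt_of_le_of_ne (Submodule.span_mono ?_) ?_
        · rintro z ⟨s, hs, hsl, rfl⟩
          refine ⟨s, hs, ?_, rfl⟩
          have := hmT (s - w) ⟨s, hs, hsl, rfl⟩
          rw [map_sub] at this
          have h' : m s = m w := by linarith
          simp [hsl, h']
        · intro heq
          have hqT : q - w ∈ Submodule.span ℝ T := by
            rw [heq]
            refine Submodule.subset_span ⟨q, hqS, ?_, rfl⟩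
            simp only [LinearMap.add_apply, LinearMap.smul_apply, smul_eq_mul]
            linarith
          have hle : Submodule.span ℝ T ≤ LinearMap.ker m :=
            Submodule.span_le.2 fun z hz => hmT z hz
          have : m (q - w) = 0 := hle hqT
          rw [map_sub] at this
          linarith
      have := Submodule.finrank_lt_finrank_of_lt hlt
      omega

theorem vertex_mem {d : ℕ} {P : Set (Euc d)} {v : Euc d} (h : IsVertexOf P v) : v ∈ P := by
  rcases h with h | ⟨l, h⟩
  · rw [← h]; rfl
  · have : v ∈ ({v} : Set (Euc d)) := rfl
    rw [h] at this
    exact this.1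

/-- Two distinct vertices are separated by a facet. -/
theorem exists_facet_sep {d : ℕ} {P : Set (Euc d)} (hP : IsPolytope P)
    (hspan : affineSpan ℝ P = ⊤) {v w : Euc d} (hv : IsVertexOf P v) (hw : IsVertexOf P w)
    (hne : v ≠ w) : ∃ F, IsFacetOf P F ∧ w ∈ F ∧ v ∉ F := by
  have hvP := vertex_mem hv
  have hwP := vertex_mem hw
  obtain ⟨l₀, h₀, h₀v⟩ : ∃ l₀ : Euc d →ₗ[ℝ] ℝ, (∀ p ∈ P, l₀ p ≤ l₀ w) ∧ l₀ v < l₀ w := by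
    rcases hw with h | ⟨l, h⟩
    · exfalso
      rw [← h] at hvP
      exact hne hvP
    · have hw1 : w ∈ ({w} : Set (Euc d)) := rfl
      rw [h] at hw1
      refine ⟨l, hw1.2, lt_of_not_ge fun hge => hne ?_⟩
      have : v ∈ ({w} : Set (Euc d)) := by
        rw [h]
        exact ⟨hvP, fun y hy => (hw1.2 y hy).trans hge⟩
      exact this
  obtain ⟨S, -, rfl⟩ := hP
  obtain ⟨l, hl, hlv, hr⟩ := exists_tight_functional S v w hspan hwP l₀
    (fun s hs => h₀ s (subset_convexHull ℝ _ hs)) h₀v (d - 1) le_rfl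
  have hlP : ∀ p ∈ convexHull ℝ (S : Set (Euc d)), l p ≤ l w := fun p hp =>
    convexHull_min (t := {z | l z ≤ l w}) (fun s hs => hl s hs)
      (convex_halfSpace_le l.isLinear (l w)) hp
  refine ⟨{p ∈ convexHull ℝ (S : Set (Euc d)) |
    ∀ y ∈ convexHull ℝ (S : Set (Euc d)), l y ≤ l p}, ⟨Or.inr ⟨l, rfl⟩, ?_⟩,
    ⟨hwP, hlP⟩, fun h => absurd (h.2 w hwP) (not_le.2 hlv)⟩
  set F := {p ∈ convexHull ℝ (S : Set (Euc d)) |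
    ∀ y ∈ convexHull ℝ (S : Set (Euc d)), l y ≤ l p} with hF
  have hwF : w ∈ F := ⟨hwP, hlP⟩
  rw [direction_affineSpan]
  apply le_antisymm
  · have hle : vectorSpan ℝ F ≤ LinearMap.ker l := by
      rw [vectorSpan_eq_span_vsub_set_right ℝ hwF, Submodule.span_le]
      rintro _ ⟨p, hp, rfl⟩
      have h1 := hp.2 w hwP
      have h2 := hlP p hp.1
      simp only [vsub_eq_sub, SetLike.mem_coe, LinearMap.mem_ker, map_sub]
      linarith
    have hlt : LinearMap.ker l < ⊤ := by
      rw [lt_top_iff_ne_top, Ne, LinearMap.ker_eq_top]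
      rintro rfl
      simp at hlv
    have h1 := Submodule.finrank_mono hle
    have h2 := Submodule.finrank_lt_finrank_of_lt hlt
    rw [finrank_top, finrank_euclideanSpace_fin] at h2
    omega
  · refine hr.trans (Submodule.finrank_mono (Submodule.span_le.2 ?_))
    rintro _ ⟨s, hs, hsl, rfl⟩
    refine vsub_mem_vectorSpan ℝ (⟨subset_convexHull ℝ _ hs, ?_⟩ : s ∈ F) hwF
    intro y hy
    rw [hsl]
    exact hlP y hy

theorem adjacent_ne {d : ℕ} {P : Set (Euc d)} {u v : Euc d} (h : AdjacentIn P u v) :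
    u ≠ v := by
  rintro rfl
  have := h.2
  rw [segment_same, direction_affineSpan, vectorSpan_singleton, finrank_bot] at this
  omega

theorem allButSimple_spindle_length_ge_succ_dim_revisits
    {d : ℕ} (P : Set (Euc d)) (x y : Euc d)
    (hspindle : IsSpindle P x y)
    (habs : ∀ v, IsVertexOf P v → v ≠ x → v ≠ y → IsSimpleVertexOf P v)
    (hlength : ∀ (k : ℕ) (u : Fin (k + 1) → Euc d), IsPathIn P x y k u → d + 1 ≤ k) :
    ∀ (k : ℕ) (u : Fin (k + 1) → Euc d), IsPathIn P x y k u →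
      ∃ F, IsFacetOf P F ∧ PathRevisits u F := by
  intro k u hu
  have hk := hlength k u hu
  obtain ⟨hu0, hul, hvert, hadj⟩ := hu
  obtain ⟨hP, hspan, hx, hy, hxy, hfac⟩ := hspindle
  by_contra! hrev
  have hd : 1 ≤ d := by
    by_contra hd
    obtain rfl : d = 0 := by omega
    exact hxy (Subsingleton.elim _ _)
  obtain ⟨k, rfl⟩ : ∃ n, k = n + 1 := ⟨k - 1, by omega⟩
  -- facets through the `i`-th vertex missing `x`
  have key : ∀ i : ℕ, ∀ hi : i ≤ k + 1, ∃ N : Finset (Set (Euc d)), i ≤ N.card ∧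
      ∀ F ∈ N, IsFacetOf P F ∧ x ∉ F ∧ u ⟨i, by omega⟩ ∈ F := by
    intro i
    induction i with
    | zero => intro _; exact ⟨∅, by simp, by simp⟩
    | succ i ih =>
      intro hi
      obtain ⟨N, hN, hNF⟩ := ih (by omega)
      have ha : u ⟨i, by omega⟩ ≠ u ⟨i + 1, by omega⟩ := adjacent_ne (hadj ⟨i, by omega⟩)
      obtain ⟨F, hF, hF1, hF2⟩ := exists_facet_sep hP hspan (hvert _) (hvert _) ha
      have hFN : F ∉ N := fun h => hF2 (hNF F h).2.2
      classical
      refine ⟨insert F N, by rw [Finset.card_insert_of_notMem hFN]; omega, ?_⟩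
      intro G hG
      rcases Finset.mem_insert.1 hG with rfl | hG
      · refine ⟨hF, fun hxG => ?_, hF1⟩
        rcases Nat.eq_zero_or_pos i with rfl | hpos
        · exact hF2 (by rw [← hu0] at hxG; exact hxG)
        · refine hrev G hF ⟨0, ⟨i, by omega⟩, ⟨i + 1, by omega⟩, ?_, ?_, ?_, hF2, hF1⟩
          · exact Fin.lt_def.2 hpos
          · exact Fin.lt_def.2 (Nat.lt_succ_self i)
          · rw [hu0]; exact hxG
      · obtain ⟨hGF, hGx, hGi⟩ := hNF G hG
        refine ⟨hGF, hGx, ?_⟩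
        have hyG : y ∈ G := (hfac G hGF).resolve_left hGx
        by_contra hcon
        rcases Nat.lt_or_ge i k with hlt | hge
        · refine hrev G hGF ⟨⟨i, by omega⟩, ⟨i + 1, by omega⟩, Fin.last _, ?_, ?_, hGi, hcon, ?_⟩
          · exact Fin.lt_def.2 (Nat.lt_succ_self i)
          · exact Fin.lt_def.2 (by simp; omega)
          · rw [hul]; exact hyG
        · obtain rfl : i = k := by omega
          apply hcon
          rw [← hul] at hyG
          exact hyG
  obtain ⟨N, hN, hNF⟩ := key k (by omega)
  set z := u ⟨k, by omega⟩ with hz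
  have hzv : IsVertexOf P z := hvert _
  have hzy : z ≠ y := by
    rw [← hul]; exact adjacent_ne (hadj ⟨k, by omega⟩)
  have hzx : z ≠ x := by
    intro h
    have hne : N.Nonempty := by rw [← Finset.card_pos]; omega
    obtain ⟨F, hF⟩ := hne
    have := hNF F hF
    rw [h] at this
    exact this.2.1 this.2.2
  obtain ⟨-, hcard⟩ := habs z hzv hzx hzy
  obtain ⟨F, hF, hF1, hF2⟩ := exists_facet_sep hP hspan hy hzv hzy.symm
  have hFx : x ∈ F := (hfac F hF).resolve_right hF2
  have hFN : F ∉ N := fun h => (hNF F h).2.1 hFx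
  classical
  have hfin : {F : Set (Euc d) | IsFacetOf P F ∧ z ∈ F}.Finite :=
    Set.finite_of_ncard_pos (by omega)
  have hsub : ((insert F N : Finset (Set (Euc d))) : Set (Set (Euc d))) ⊆
      {F : Set (Euc d) | IsFacetOf P F ∧ z ∈ F} := by
    intro G hG
    rcases Finset.mem_insert.1 (Finset.mem_coe.1 hG) with rfl | hG
    · exact ⟨hF, hF1⟩
    · exact ⟨(hNF G hG).1, (hNF G hG).2.2⟩
  have := Set.ncard_le_ncard hsub hfin
  rw [Set.ncard_coe_finset, Finset.card_insert_of_notMem hFN, hcard] at this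
  omega
end
end

section
/- Let (P, x, y) be a d-dimensional spindle and let u_0 = x, u_1, …, u_k = y be a path from x to y such that every intermediate vertex u_1, …, u_{k−1} is a simple vertex of P and the path revisits no facet of P. Then k ≤ d. -/
/-!
STATEMENT 0: A d-dimensional all-but-simple spindle (P, x, y) whose length
(minimal length of a path from x to y) is at least d + 1 is a counterexample to
the nonrevisiting conjecture: every path from x to y revisits some facet.
-/

noncomputable section

lemma aux_separate {d : ℕ} (S : Finset (Euc d)) (v w : Euc d)
    (hspan : affineSpan ℝ (S : Set (Euc d)) = ⊤)
    (l : Euc d →ₗ[ℝ] ℝ) (hl : ∀ s ∈ S, l (s - v) ≤ 0) (hlw : l (w - v) < 0) :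
    ∀ n : ℕ, n + 1 ≤ d → ∃ f : Euc d →ₗ[ℝ] ℝ, (∀ s ∈ S, f (s - v) ≤ 0) ∧ f (w - v) < 0 ∧
      n ≤ Module.finrank ℝ (Submodule.span ℝ {z : Euc d | ∃ s ∈ S, z = s - v ∧ f z = 0}) := by
  intro n
  induction n with
  | zero => exact fun _ => ⟨l, hl, hlw, Nat.zero_le _⟩
  | succ n ih =>
    intro hn
    obtain ⟨f, hf, hfw, hr⟩ := ih (by omega)
    set L := Submodule.span ℝ {z : Euc d | ∃ s ∈ S, z = s - v ∧ f z = 0} with hL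
    by_cases hbig : n + 1 ≤ Module.finrank ℝ L
    · exact ⟨f, hf, hfw, hbig⟩
    have hlt : L ⊔ Submodule.span ℝ {w - v} < ⊤ := by
      rw [lt_top_iff_ne_top]
      intro htop
      have h1 := Submodule.finrank_add_le_finrank_add_finrank L (Submodule.span ℝ {w - v})
      have h2 : Module.finrank ℝ (Submodule.span ℝ {w - v}) ≤ 1 := by
        simpa using finrank_span_le_card (R := ℝ) ({w - v} : Set (Euc d))
      rw [htop, finrank_top, finrank_euclideanSpace_fin] at h1
      omega
    obtain ⟨g₀, hg₀, hg₀L⟩ := Submodule.exists_le_ker_of_lt_top _ hlt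
    have hex : ∃ s ∈ S, g₀ (s - v) ≠ 0 := by
      by_contra hcon
      push Not at hcon
      apply hg₀
      have hle : affineSpan ℝ (S : Set (Euc d)) ≤ AffineSubspace.mk' v (LinearMap.ker g₀) := by
        rw [affineSpan_le]
        intro s hs
        simpa [AffineSubspace.mem_mk'] using hcon s hs
      rw [hspan] at hle
      ext1 i
      have := hle (AffineSubspace.mem_top ℝ (Euc d) (i + v))
      simpa [AffineSubspace.mem_mk'] using this
    obtain ⟨s₀, hs₀, hgs₀⟩ := hex
    obtain ⟨g, hgL, hgpos⟩ : ∃ g : Euc d →ₗ[ℝ] ℝ,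
        L ⊔ Submodule.span ℝ {w - v} ≤ LinearMap.ker g ∧ 0 < g (s₀ - v) := by
      rcases lt_or_gt_of_ne hgs₀ with h | h
      · refine ⟨-g₀, fun z hz => ?_, by simpa using h⟩
        have := hg₀L hz
        rw [LinearMap.mem_ker] at this ⊢
        simp [this]
      · exact ⟨g₀, hg₀L, h⟩
    have hgw : g (w - v) = 0 :=
      hgL (Submodule.mem_sup_right (Submodule.mem_span_singleton_self _))
    have hgL' : ∀ z ∈ L, g z = 0 := fun z hz => hgL (Submodule.mem_sup_left hz)
    let T := S.filter (fun s => 0 < g (s - v))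
    obtain ⟨m, hm, hmin⟩ := T.exists_min_image (fun s => - f (s - v) / g (s - v))
      ⟨s₀, Finset.mem_filter.2 ⟨hs₀, hgpos⟩⟩
    obtain ⟨hmS, hmg⟩ := Finset.mem_filter.1 hm
    set t := - f (m - v) / g (m - v) with ht
    have ht0 : 0 ≤ t := div_nonneg (by linarith [hf m hmS]) hmg.le
    have hmem : ∀ s ∈ S, (f + t • g) (s - v) ≤ 0 := by
      intro s hs
      rw [LinearMap.add_apply, LinearMap.smul_apply, smul_eq_mul]
      by_cases hp : 0 < g (s - v)
      · have := hmin s (Finset.mem_filter.2 ⟨hs, hp⟩)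
        rw [le_div_iff₀ hp] at this
        linarith
      · have := mul_nonpos_of_nonneg_of_nonpos ht0 (not_lt.1 hp)
        linarith [hf s hs]
    refine ⟨f + t • g, hmem, ?_, ?_⟩
    · rw [LinearMap.add_apply, LinearMap.smul_apply, hgw]; simpa using hfw
    · have hlt2 : L < Submodule.span ℝ
          {z : Euc d | ∃ s ∈ S, z = s - v ∧ (f + t • g) z = 0} := by
        refine lt_of_le_of_ne ?_ ?_
        · apply Submodule.span_mono
          rintro z ⟨s, hs, hz, hfz⟩
          refine ⟨s, hs, hz, ?_⟩
          have : g z = 0 := hgL' z (Submodule.subset_span ⟨s, hs, hz, hfz⟩)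
          simp [hfz, this]
        · intro heq
          have : m - v ∈ L := by
            rw [heq]
            refine Submodule.subset_span ⟨m, hmS, rfl, ?_⟩
            rw [LinearMap.add_apply, LinearMap.smul_apply, smul_eq_mul, ht,
              div_mul_cancel₀ _ hmg.ne']
            ring
          exact hmg.ne' (hgL' _ this)
      have := Submodule.finrank_lt_finrank_of_lt hlt2
      omega

lemma exists_facet {d : ℕ} (hd : 1 ≤ d) (P : Set (Euc d)) (hP : IsPolytope P)
    (hspan : affineSpan ℝ P = ⊤) (v w : Euc d) (hv : IsVertexOf P v) (hw : w ∈ P)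
    (hne : w ≠ v) : ∃ F, IsFacetOf P F ∧ v ∈ F ∧ w ∉ F := by
  obtain ⟨S, -, rfl⟩ := hP
  rw [affineSpan_convexHull] at hspan
  have hSP : ∀ s ∈ S, s ∈ convexHull ℝ (S : Set (Euc d)) := fun s hs =>
    subset_convexHull ℝ _ hs
  rcases hv with hv | ⟨l, hl⟩
  · rw [← hv] at hw
    exact absurd hw hne
  have hvm : v ∈ {x ∈ convexHull ℝ (S : Set (Euc d)) |
      ∀ y ∈ convexHull ℝ (S : Set (Euc d)), l y ≤ l x} := by
    rw [← hl]; rfl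
  have hlw : l (w - v) < 0 := by
    rw [map_sub, sub_neg]
    by_contra hcon
    push Not at hcon
    apply hne
    have : w ∈ ({v} : Set (Euc d)) := by
      rw [hl]
      exact ⟨hw, fun y hy => (hvm.2 y hy).trans hcon⟩
    exact this
  obtain ⟨f, hf, hfw, hr⟩ := aux_separate S v w hspan l
    (fun s hs => by rw [map_sub]; linarith [hvm.2 s (hSP s hs)]) hlw (d - 1) (by omega)
  have hfP : ∀ p ∈ convexHull ℝ (S : Set (Euc d)), f p ≤ f v := by
    have hc : Convex ℝ {p : Euc d | f p ≤ f v} := convex_halfSpace_le f.isLinear _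
    have := convexHull_min (s := (S : Set (Euc d))) (t := {p | f p ≤ f v})
      (fun s hs => by
        have := hf s hs
        rw [map_sub] at this
        show f s ≤ f v
        linarith) hc
    exact fun p hp => this hp
  rw [map_sub] at hfw
  refine ⟨{x ∈ convexHull ℝ (S : Set (Euc d)) |
      ∀ y ∈ convexHull ℝ (S : Set (Euc d)), f y ≤ f x}, ⟨Or.inr ⟨f, rfl⟩, ?_⟩,
      ⟨hvm.1, hfP⟩, fun h => by linarith [h.2 v hvm.1]⟩
  set F := {x ∈ convexHull ℝ (S : Set (Euc d)) |
      ∀ y ∈ convexHull ℝ (S : Set (Euc d)), f y ≤ f x} with hF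
  have hvF : v ∈ F := ⟨hvm.1, hfP⟩
  rw [direction_affineSpan]
  apply le_antisymm
  · have hle : vectorSpan ℝ F ≤ LinearMap.ker f := by
      rw [vectorSpan_def, Submodule.span_le]
      rintro _ ⟨a, ha, b, hb, rfl⟩
      have h1 := ha.2 b hb.1
      have h2 := hb.2 a ha.1
      simp only [SetLike.mem_coe, LinearMap.mem_ker, vsub_eq_sub, map_sub]
      linarith
    have hlt : vectorSpan ℝ F < ⊤ := by
      refine lt_of_le_of_lt hle (lt_top_iff_ne_top.2 fun h => ?_)
      rw [LinearMap.ker_eq_top] at h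
      simp [h] at hfw
    have := Submodule.finrank_lt hlt.ne
    rw [finrank_euclideanSpace_fin] at this
    omega
  · refine hr.trans (Submodule.finrank_mono ?_)
    rw [Submodule.span_le]
    rintro z ⟨s, hs, rfl, hz⟩
    rw [map_sub] at hz
    exact vsub_mem_vectorSpan ℝ
      (⟨hSP s hs, fun y hy => by linarith [hfP y hy]⟩ : s ∈ F) hvF

/-- in a d-dimensional spindle, a nonrevisiting path from x to y all
of whose intermediate vertices are simple has length at most d. -/
theorem nonrevisiting_simple_path_in_spindle_le_dim
    {d : ℕ} (P : Set (Euc d)) (x y : Euc d)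
    (hspindle : IsSpindle P x y)
    (k : ℕ) (u : Fin (k + 1) → Euc d)
    (hpath : IsPathIn P x y k u)
    (hsimple : ∀ i : Fin (k + 1), i ≠ 0 → i ≠ Fin.last k → IsSimpleVertexOf P (u i))
    (hnorevisit : ∀ F, IsFacetOf P F → ¬ PathRevisits u F) :
    k ≤ d := by
  obtain ⟨hP, hspan, hvx, hvy, hxy, hfac⟩ := hspindle
  obtain ⟨hu0, huk, hver, hadj⟩ := hpath
  have hd : 1 ≤ d := by
    rcases Nat.eq_zero_or_pos d with rfl | h
    · exact absurd (Subsingleton.elim x y) hxy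
    · exact h
  rcases Nat.lt_or_ge k 2 with hk | hk
  · omega
  have hmem : ∀ i, u i ∈ P := by
    intro i
    rcases hver i with h | ⟨l, h⟩
    · rw [← h]; rfl
    · have : u i ∈ ({u i} : Set (Euc d)) := rfl
      rw [h] at this
      exact this.1
  have hne : ∀ i : Fin k, u i.castSucc ≠ u i.succ := by
    intro i h
    have := (hadj i).2
    rw [h, segment_same, direction_affineSpan, vectorSpan_singleton] at this
    simp at this
  -- entering facets
  have hent : ∀ i : Fin k, ∃ F, IsFacetOf P F ∧ u i.succ ∈ F ∧ u i.castSucc ∉ F := fun i =>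
    exists_facet hd P hP hspan _ _ (hver _) (hmem _) (hne i)
  choose F hF hFs hFc using hent
  obtain ⟨m, rfl⟩ : ∃ m, k = m + 1 := ⟨k - 1, by omega⟩
  obtain ⟨G, hG, hGs, hGc⟩ := exists_facet hd P hP hspan _ _ (hver (Fin.last m).castSucc)
    (hmem (Fin.last m).succ) (hne (Fin.last m)).symm
  have hyF : ∀ i : Fin m, y ∈ F i.castSucc := by
    intro i
    rcases hfac _ (hF i.castSucc) with h | h
    · exfalso
      rw [← hu0] at h
      refine hnorevisit _ (hF i.castSucc)
        ⟨0, i.castSucc.castSucc, i.castSucc.succ, ?_, Fin.castSucc_lt_succ, h, hFc _, hFs _⟩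
      rw [Fin.pos_iff_ne_zero]
      intro h0
      have := hFc i.castSucc
      rw [h0] at this
      exact this h
    · exact h
  have hstay : ∀ (i : Fin m) (j : Fin (m + 2)), i.castSucc.succ ≤ j → u j ∈ F i.castSucc := by
    intro i j hij
    by_contra hcon
    refine hnorevisit _ (hF i.castSucc)
      ⟨i.castSucc.succ, j, Fin.last _, lt_of_le_of_ne hij ?_, 
        lt_of_le_of_ne (Fin.le_last _) ?_, hFs _, hcon, by rw [huk]; exact hyF i⟩
    · rintro rfl; exact hcon (hFs _)
    · rintro rfl; exact hcon (by rw [huk]; exact hyF i)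
  have hinj : ∀ i j : Fin m, i < j → F i.castSucc ≠ F j.castSucc := by
    intro i j hij h
    apply hFc j.castSucc
    rw [← h]
    apply hstay
    simp [Fin.le_def]
    exact hij
  have hS := (hsimple (Fin.last m).castSucc (by
    intro h; have := congrArg Fin.val h; simp at this; omega) (by
    intro h; have := congrArg Fin.val h; simp at this)).2
  let φ : Option (Fin m) → Set (Euc d) := fun o => o.elim G (fun i => F i.castSucc)
  have hφ : Function.Injective φ := by
    have hGF : ∀ i : Fin m, G ≠ F i.castSucc := by
      intro i h
      apply hGc
      rw [h, Fin.succ_last, huk]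
      exact hyF i
    rintro (_ | i) (_ | j) h
    · rfl
    · exact absurd h (hGF j)
    · exact absurd h.symm (hGF i)
    · rcases lt_trichotomy i j with hij | rfl | hij
      · exact absurd h (hinj _ _ hij)
      · rfl
      · exact absurd h.symm (hinj _ _ hij)
  have hsub : Set.range φ ⊆ {F | IsFacetOf P F ∧ u (Fin.last m).castSucc ∈ F} := by
    rintro _ ⟨_ | i, rfl⟩
    · exact ⟨hG, hGs⟩
    · refine ⟨hF _, hstay _ _ ?_⟩
      simp [Fin.le_def]
  have hcard := Set.ncard_le_ncard hsub (Set.finite_of_ncard_ne_zero (by omega))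
  rw [hS, Set.ncard_range_of_injective hφ] at hcard
  simpa using hcard
end
end

section
/- Let X and Y be disjoint finite sets, let d ≥ 1, and let S_1, …, S_k be finite subsets of X ∪ Y, each of cardinality d, such that |S_1 ∩ X| = d − 1 and, for each 1 ≤ i ≤ k − 1, the set S_{i+1} \ S_i is a singleton contained in Y and S_i \ S_{i+1} is contained in X. Then for every 1 ≤ j ≤ k one has |S_j ∩ X| = d − j; in particular k ≤ d. -/
/-!
STATEMENT 3: the combinatorial core of the facet-departure/facet-arrival counting
argument. X and Y are disjoint finite sets, S 1, …, S k are d-element subsets of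
X ∪ Y with |S 1 ∩ X| = d - 1, and each step gains exactly one element of Y and
loses only elements of X. Then |S j ∩ X| = d - j for all 1 ≤ j ≤ k; in
particular k ≤ d.
-/

theorem departure_arrival_counting {α : Type*} [DecidableEq α]
    (X Y : Finset α) (hXY : Disjoint X Y)
    (d k : ℕ) (hd : 1 ≤ d) (hk : 1 ≤ k)
    (S : ℕ → Finset α)
    (hsub : ∀ i, 1 ≤ i → i ≤ k → S i ⊆ X ∪ Y)
    (hcard : ∀ i, 1 ≤ i → i ≤ k → (S i).card = d)
    (hS1 : (S 1 ∩ X).card = d - 1)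
    (hstep : ∀ i, 1 ≤ i → i ≤ k - 1 →
      (∃ a ∈ Y, S (i + 1) \ S i = {a}) ∧ S i \ S (i + 1) ⊆ X) :
    (∀ j, 1 ≤ j → j ≤ k → (S j ∩ X).card = d - j) ∧ k ≤ d := by
  have key : ∀ j, 1 ≤ j → j ≤ k → (S j ∩ X).card + j = d := by
    intro j hj
    induction j, hj using Nat.le_induction with
    | base => intro _; omega
    | succ i hi ih =>
      intro hik
      have h0 := ih (by omega)
      obtain ⟨⟨a, haY, ha⟩, hX⟩ := hstep i hi (by omega)
      have hc : (S i \ S (i + 1)).card = 1 := by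
        have h1 := Finset.card_sdiff_add_card_inter (S i) (S (i + 1))
        have h2 := Finset.card_sdiff_add_card_inter (S (i + 1)) (S i)
        rw [ha, Finset.card_singleton, Finset.inter_comm] at h2
        rw [hcard i hi (by omega)] at h1
        rw [hcard (i + 1) (by omega) hik] at h2
        omega
      have haX : a ∉ X := fun h => Finset.disjoint_left.mp hXY h haY
      obtain ⟨b, hb⟩ := Finset.card_eq_one.mp hc
      have hb1 : b ∈ S i \ S (i + 1) := by rw [hb]; exact Finset.mem_singleton_self b
      have hbX := hX hb1
      rw [Finset.mem_sdiff] at hb1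
      have he : S i ∩ X = insert b (S (i + 1) ∩ X) := by
        ext x
        have e1 := Finset.ext_iff.mp ha x
        have e2 := Finset.ext_iff.mp hb x
        simp only [Finset.mem_sdiff, Finset.mem_singleton] at e1 e2
        simp only [Finset.mem_inter, Finset.mem_insert]
        grind
      rw [he, Finset.card_insert_of_notMem (by simp [hb1.2])] at h0
      omega
  refine ⟨fun j h1 h2 => ?_, ?_⟩
  · have := key j h1 h2
    omega
  · have := key k hk le_rfl
    omega
end

section
/- The extreme points of the wedge W are exactly the following points: (v, 0) for each extreme point v of P with a₁ · v = b₁, and the two points (v, b₁ − a₁ · v) and (v, −(b₁ − a₁ · v)) for each extreme point v of P with a₁ · v < b₁. Consequently, if P has m extreme points of which f lie on the facet F₁, then W has exactly 2m − f extreme points. -/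
/-!
STATEMENT 4: description of the extreme points of the wedge
`W = ω_{F₁}(P)` of the polytope `P = {z : aᵢ·z ≤ bᵢ, 1 ≤ i ≤ n}` over its facet
`F₁`, together with the count `2m - f`.
-/

open scoped RealInnerProductSpace

noncomputable section

theorem wedge_extremePoints
    (d n : ℕ) (hd : 2 ≤ d) (hn : 2 ≤ n)
    (a : ℕ → Euc d) (b : ℕ → ℝ)
    (P : Set (Euc d))
    (hP : P = {z : Euc d | ∀ i, 1 ≤ i → i ≤ n → ⟪a i, z⟫ ≤ b i})
    (hPcompact : IsCompact P)
    (hPint : (interior P).Nonempty)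
    (hfacets : ∀ i, 1 ≤ i → i ≤ n →
      Module.finrank ℝ (affineSpan ℝ {z ∈ P | ⟪a i, z⟫ = b i}).direction = d - 1)
    (W : Set (Euc d × ℝ))
    (hW : W = {p : Euc d × ℝ | ⟪a 1, p.1⟫ + p.2 ≤ b 1 ∧ ⟪a 1, p.1⟫ - p.2 ≤ b 1 ∧
      ∀ i, 2 ≤ i → i ≤ n → ⟪a i, p.1⟫ ≤ b i}) :
    (Set.extremePoints ℝ W =
      {p : Euc d × ℝ |
        (∃ v ∈ Set.extremePoints ℝ P, ⟪a 1, v⟫ = b 1 ∧ p = (v, (0 : ℝ))) ∨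
        (∃ v ∈ Set.extremePoints ℝ P, ⟪a 1, v⟫ < b 1 ∧
          (p = (v, b 1 - ⟪a 1, v⟫) ∨ p = (v, -(b 1 - ⟪a 1, v⟫))))}) ∧
    ∀ m f : ℕ, (Set.extremePoints ℝ P).ncard = m →
      {v ∈ Set.extremePoints ℝ P | ⟪a 1, v⟫ = b 1}.ncard = f →
      (Set.extremePoints ℝ W).ncard = 2 * m - f := by
  have hWm : ∀ z t, (z, t) ∈ W ↔ z ∈ P ∧ t ≤ b 1 - ⟪a 1, z⟫ ∧ -t ≤ b 1 - ⟪a 1, z⟫ := by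
    intro z t
    rw [hW, hP]
    simp only [Set.mem_setOf_eq]
    constructor
    · rintro ⟨h1, h2, h3⟩
      refine ⟨fun i hi hin => ?_, by linarith, by linarith⟩
      rcases Nat.lt_or_ge i 2 with h | h
      · obtain rfl : i = 1 := by omega
        linarith
      · exact h3 i h hin
    · rintro ⟨h1, h2, h3⟩
      exact ⟨by linarith, by linarith, fun i hi hin => h1 i (by omega) hin⟩
  have hPs : ∀ z ∈ P, 0 ≤ b 1 - ⟪a 1, z⟫ := by
    intro z hz
    rw [hP] at hz
    have := hz 1 le_rfl (by omega)
    linarith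
  have hlin : ∀ (α β : ℝ) (x y : Euc d), ⟪a 1, α • x + β • y⟫ = α * ⟪a 1, x⟫ + β * ⟪a 1, y⟫ := by
    intro α β x y
    rw [inner_add_right, inner_smul_right, inner_smul_right]
  -- graph points
  have hup : ∀ (ε : ℝ), (ε = 1 ∨ ε = -1) → ∀ v,
      (v, ε * (b 1 - ⟪a 1, v⟫)) ∈ Set.extremePoints ℝ W ↔ v ∈ Set.extremePoints ℝ P := by
    intro ε hε v
    have hmem : ∀ z ∈ P, (z, ε * (b 1 - ⟪a 1, z⟫)) ∈ W := by
      intro z hz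
      have := hPs z hz
      rw [hWm]
      rcases hε with rfl | rfl
      · exact ⟨hz, by linarith, by linarith⟩
      · exact ⟨hz, by linarith, by linarith⟩
    rw [mem_extremePoints, mem_extremePoints]
    constructor
    · rintro ⟨h1, h2⟩
      refine ⟨((hWm _ _).1 h1).1, ?_⟩
      rintro x hx y hy ⟨α, β, hα, hβ, hab, rfl⟩
      have := h2 _ (hmem x hx) _ (hmem y hy) ⟨α, β, hα, hβ, hab, by
        refine Prod.ext rfl ?_
        simp only [Prod.snd_add, Prod.smul_snd, smul_eq_mul, hlin]
        obtain rfl : β = 1 - α := by linarith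
        ring⟩
      exact ⟨congrArg Prod.fst this.1, congrArg Prod.fst this.2⟩
    · rintro ⟨h1, h2⟩
      refine ⟨hmem v h1, ?_⟩
      rintro ⟨x, t⟩ hx ⟨y, u⟩ hy ⟨α, β, hα, hβ, hab, h⟩
      rw [hWm] at hx hy
      have hf : α • x + β • y = v := congrArg Prod.fst h
      have hs : α * t + β * u = ε * (b 1 - ⟪a 1, v⟫) := congrArg Prod.snd h
      obtain ⟨rfl, h4⟩ := h2 x hx.1 y hy.1 ⟨α, β, hα, hβ, hab, hf⟩
      subst h4
      obtain ⟨-, hx1, hx2⟩ := hx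
      obtain ⟨-, hy1, hy2⟩ := hy
      generalize b 1 - ⟪a 1, y⟫ = s at *
      obtain rfl : β = 1 - α := by linarith
      have ht : t = ε * s := by
        rcases hε with rfl | rfl <;> nlinarith
      have hu : u = ε * s := by
        rcases hε with rfl | rfl <;> nlinarith
      exact ⟨by rw [ht], by rw [hu]⟩
  have hgr : ∀ z t, (z, t) ∈ Set.extremePoints ℝ W →
      t = b 1 - ⟪a 1, z⟫ ∨ t = -(b 1 - ⟪a 1, z⟫) := by
    intro z t h
    rw [mem_extremePoints] at h
    obtain ⟨h1, h2⟩ := h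
    rw [hWm] at h1
    obtain ⟨hz, ht1, ht2⟩ := h1
    by_contra! hne
    have h3 := lt_of_le_of_ne ht1 hne.1
    have h4 : -t < b 1 - ⟪a 1, z⟫ := lt_of_le_of_ne ht2 (fun h => hne.2 (by linarith))
    have hs := hPs z hz
    have h5 := h2 (z, b 1 - ⟪a 1, z⟫) ((hWm _ _).2 ⟨hz, le_rfl, by linarith⟩)
      (z, -(b 1 - ⟪a 1, z⟫)) ((hWm _ _).2 ⟨hz, by linarith, by linarith⟩)
    generalize b 1 - ⟪a 1, z⟫ = s at *
    have hs' : 0 < s := by linarith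
    have := h5 ⟨(s + t) / (2 * s), (s - t) / (2 * s), div_pos (by linarith) (by linarith),
      div_pos (by linarith) (by linarith), by field_simp; ring, by
        refine Prod.ext ?_ ?_
        · simp only [Prod.fst_add, Prod.smul_fst]
          rw [← add_smul]
          have : (s + t) / (2 * s) + (s - t) / (2 * s) = 1 := by field_simp; ring
          rw [this, one_smul]
        · simp only [Prod.snd_add, Prod.smul_snd, smul_eq_mul]
          field_simp; ring⟩
    exact hne.1 (congrArg Prod.snd this.1).symm
  have hup1 : ∀ v, (v, b 1 - ⟪a 1, v⟫) ∈ Set.extremePoints ℝ W ↔ v ∈ Set.extremePoints ℝ P := by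
    intro v
    simpa only [one_mul] using hup 1 (Or.inl rfl) v
  have hdn1 : ∀ v, (v, -(b 1 - ⟪a 1, v⟫)) ∈ Set.extremePoints ℝ W ↔
      v ∈ Set.extremePoints ℝ P := by
    intro v
    simpa only [neg_one_mul] using hup (-1) (Or.inr rfl) v
  refine ⟨?_, ?_⟩
  · ext ⟨z, t⟩
    simp only [Set.mem_setOf_eq]
    constructor
    · intro h
      have hz : z ∈ Set.extremePoints ℝ P := by
        rcases hgr z t h with rfl | rfl
        · exact (hup1 z).1 h
        · exact (hdn1 z).1 h
      have h0 := hPs z hz.1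
      rcases h0.eq_or_lt with h0 | h0
      · left
        refine ⟨z, hz, by linarith, Prod.ext rfl ?_⟩
        rcases hgr z t h with h | h <;> simp only <;> linarith
      · right
        refine ⟨z, hz, by linarith, ?_⟩
        rcases hgr z t h with h | h
        · left; rw [h]
        · right; rw [h]
    · rintro (⟨v, hv, h, he⟩ | ⟨v, hv, h, he | he⟩)
      · rw [he]
        have := (hup1 v).2 hv
        rwa [h, sub_self] at this
      · rw [he]; exact (hup1 v).2 hv
      · rw [he]; exact (hdn1 v).2 hv
  · intro m f hm hf
    set E := Set.extremePoints ℝ P with hE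
    let g : Euc d → Euc d × ℝ := fun v => (v, b 1 - ⟪a 1, v⟫)
    let k : Euc d → Euc d × ℝ := fun v => (v, -(b 1 - ⟪a 1, v⟫))
    have hg : Function.Injective g := fun x y h => congrArg Prod.fst h
    have hk : Function.Injective k := fun x y h => congrArg Prod.fst h
    have hU : Set.extremePoints ℝ W = g '' E ∪ k '' E := by
      ext ⟨z, t⟩
      constructor
      · intro h
        rcases hgr z t h with rfl | rfl
        · exact Or.inl ⟨z, (hup1 z).1 h, rfl⟩
        · exact Or.inr ⟨z, (hdn1 z).1 h, rfl⟩
      · rintro (⟨v, hv, h⟩ | ⟨v, hv, h⟩)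
        · rw [← h]; exact (hup1 v).2 hv
        · rw [← h]; exact (hdn1 v).2 hv
    have hI : g '' E ∩ k '' E = g '' {v ∈ E | ⟪a 1, v⟫ = b 1} := by
      ext p
      constructor
      · rintro ⟨⟨v, hv, rfl⟩, ⟨w, hw, h⟩⟩
        have h1 : w = v := congrArg Prod.fst h
        subst h1
        have h2 : -(b 1 - ⟪a 1, w⟫) = b 1 - ⟪a 1, w⟫ := congrArg Prod.snd h
        exact ⟨w, ⟨hv, by linarith⟩, rfl⟩
      · rintro ⟨v, ⟨hv, h⟩, rfl⟩
        refine ⟨⟨v, hv, rfl⟩, ⟨v, hv, Prod.ext rfl ?_⟩⟩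
        simp only [g, k, h]
        simp
    by_cases hfin : E.Finite
    · have := Set.ncard_union_add_ncard_inter (g '' E) (k '' E) (hfin.image g) (hfin.image k)
      rw [hI, Set.ncard_image_of_injective _ hg, Set.ncard_image_of_injective _ hg,
        Set.ncard_image_of_injective _ hk, ← hU, hm, hf] at this
      omega
    · have h1 : (Set.extremePoints ℝ W).Infinite := by
        rw [hU]
        exact (Set.Infinite.image hg.injOn hfin).mono Set.subset_union_left
      rw [h1.ncard]
      have h2 : E.ncard = 0 := Set.Infinite.ncard hfin
      omega
end
end

section
/- Let y be an extreme point of P with a₁ · y < b₁ and aₙ · y = bₙ, and suppose {z ∈ ℝ^d : aᵢ · z = bᵢ for all i with 2 ≤ i ≤ n − 1 and aᵢ · y = bᵢ} = {y} (the facets incident to y other than G = Fₙ already pin y). Then for every ε > 0, the point y₀ = (y, 0) is an extreme point of the perturbed wedge W_ε, and it lies on the perturbed facet, i.e., aₙ · y + ε · 0 = bₙ. -/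
/-!
STATEMENT 8: if the facets incident to `y` other than `G = Fₙ` already pin `y`,
then for every `ε > 0` the point `y₀ = (y, 0)` is an extreme point (vertex) of
the perturbed wedge `W_ε`, lying on the perturbed facet.
-/

open scoped RealInnerProductSpace

noncomputable section

theorem perturbedWedge_new_vertex_y0
    (d n : ℕ) (hd : 2 ≤ d) (hn : 3 ≤ n)
    (a : ℕ → Euc d) (b : ℕ → ℝ)
    (P : Set (Euc d))
    (hP : P = {z : Euc d | ∀ i, 1 ≤ i → i ≤ n → ⟪a i, z⟫ ≤ b i})
    (hPcompact : IsCompact P)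
    (hPint : (interior P).Nonempty)
    (hfacets : ∀ i, 1 ≤ i → i ≤ n →
      Module.finrank ℝ (affineSpan ℝ {z ∈ P | ⟪a i, z⟫ = b i}).direction = d - 1)
    (y : Euc d) (hy : y ∈ Set.extremePoints ℝ P)
    (hy1 : ⟪a 1, y⟫ < b 1) (hyn : ⟪a n, y⟫ = b n)
    (hpinned : {z : Euc d | ∀ i, 2 ≤ i → i ≤ n - 1 → ⟪a i, y⟫ = b i → ⟪a i, z⟫ = b i}
      = {y}) :
    ∀ ε : ℝ, 0 < ε →
      ((y, (0 : ℝ)) ∈ Set.extremePoints ℝ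
        {p : Euc d × ℝ | ⟪a 1, p.1⟫ + p.2 ≤ b 1 ∧ ⟪a 1, p.1⟫ - p.2 ≤ b 1 ∧
          (∀ i, 2 ≤ i → i ≤ n - 1 → ⟪a i, p.1⟫ ≤ b i) ∧
          ⟪a n, p.1⟫ + ε * p.2 ≤ b n}) ∧
      ⟪a n, y⟫ + ε * 0 = b n := by
  intro ε hε
  have hyP : ∀ i, 1 ≤ i → i ≤ n → ⟪a i, y⟫ ≤ b i := by
    have h := hy.1
    rw [hP] at h
    exact h
  refine ⟨?_, by rw [hyn]; ring⟩
  -- a convex combination attaining the common upper bound has its endpoint on the bound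
  have key : ∀ s t u v c : ℝ, 0 < s → 0 < t → s + t = 1 → u ≤ c → v ≤ c →
      s * u + t * v = c → u = c := by
    intro s t u v c hs ht hst hu hv h
    have hs' : s = 1 - t := by linarith
    have h1 : s * (c - u) + t * (c - v) = 0 := by
      subst hs'
      linarith
    have h2 : 0 ≤ t * (c - v) := mul_nonneg ht.le (by linarith)
    by_contra hne
    have h3 : 0 < s * (c - u) :=
      mul_pos hs (by linarith [lt_of_le_of_ne hu hne])
    linarith
  rw [mem_extremePoints_iff_left]
  refine ⟨⟨by simpa using hy1.le, by simpa using hy1.le,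
    fun i h1 h2 => hyP i (by omega) (by omega), by simp [hyn]⟩, ?_⟩
  rintro ⟨z, p⟩ ⟨-, -, hz, hzn⟩ ⟨w, q⟩ ⟨-, -, hw, hwn⟩ ⟨s, t, hs, ht, hst, h⟩
  obtain ⟨hzw, hpq⟩ := Prod.ext_iff.1 h
  simp only [Prod.fst_add, Prod.smul_fst, Prod.snd_add, Prod.smul_snd, smul_eq_mul] at *
  have pin : ∀ x : Euc d, (∀ i, 2 ≤ i → i ≤ n - 1 → ⟪a i, y⟫ = b i → ⟪a i, x⟫ = b i) →
      x = y := by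
    intro x hx
    have hx' : x ∈ ({y} : Set (Euc d)) := by
      rw [← hpinned]
      exact hx
    exact hx'
  have comb : ∀ i, s * ⟪a i, z⟫ + t * ⟪a i, w⟫ = ⟪a i, y⟫ := by
    intro i
    rw [← hzw, inner_add_right, real_inner_smul_right, real_inner_smul_right]
  have ez : z = y := pin z fun i h1 h2 h3 =>
    key s t _ _ _ hs ht hst (hz i h1 h2) (hw i h1 h2) ((comb i).trans h3)
  have ew : w = y := pin w fun i h1 h2 h3 =>
    key t s _ _ _ ht hs (by linarith) (hw i h1 h2) (hz i h1 h2)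
      (by rw [add_comm]; exact (comb i).trans h3)
  subst ez
  subst ew
  have hp : p ≤ 0 := by
    by_contra hc
    have := mul_pos hε (not_le.1 hc)
    linarith
  have hq : q ≤ 0 := by
    by_contra hc
    have := mul_pos hε (not_le.1 hc)
    linarith
  rw [key s t p q 0 hs ht hst hp hq hpq]
end
end

section
/- Let y be an extreme point of P with a₁ · y < b₁ and aₙ · y = bₙ, and suppose {z ∈ ℝ^d : aᵢ · z = bᵢ for all i with 2 ≤ i ≤ n − 1 and aᵢ · y = bᵢ} = {y} (the facets incident to y other than G = Fₙ already pin y). Then for every ε > 0, the base image y_b = (y, −(b₁ − a₁ · y)) is an extreme point of the perturbed wedge W_ε, and it satisfies the perturbed inequality strictly: aₙ · y + ε · (−(b₁ − a₁ · y)) < bₙ. -/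
/-!
STATEMENT 9: if the facets incident to `y` other than `G = Fₙ` already pin `y`,
then for every `ε > 0` the base image `y_b = (y, -(b₁ - a₁·y))` remains an
extreme point (vertex) of the perturbed wedge `W_ε`, and it satisfies the
perturbed inequality strictly.
-/

open scoped RealInnerProductSpace

noncomputable section

theorem perturbedWedge_base_vertex_survives
    (d n : ℕ) (hd : 2 ≤ d) (hn : 3 ≤ n)
    (a : ℕ → Euc d) (b : ℕ → ℝ)
    (P : Set (Euc d))
    (hP : P = {z : Euc d | ∀ i, 1 ≤ i → i ≤ n → ⟪a i, z⟫ ≤ b i})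
    (hPcompact : IsCompact P)
    (hPint : (interior P).Nonempty)
    (hfacets : ∀ i, 1 ≤ i → i ≤ n →
      Module.finrank ℝ (affineSpan ℝ {z ∈ P | ⟪a i, z⟫ = b i}).direction = d - 1)
    (y : Euc d) (hy : y ∈ Set.extremePoints ℝ P)
    (hy1 : ⟪a 1, y⟫ < b 1) (hyn : ⟪a n, y⟫ = b n)
    (hpinned : {z : Euc d | ∀ i, 2 ≤ i → i ≤ n - 1 → ⟪a i, y⟫ = b i → ⟪a i, z⟫ = b i}
      = {y}) :
    ∀ ε : ℝ, 0 < ε →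
      ((y, -(b 1 - ⟪a 1, y⟫)) ∈ Set.extremePoints ℝ
        {p : Euc d × ℝ | ⟪a 1, p.1⟫ + p.2 ≤ b 1 ∧ ⟪a 1, p.1⟫ - p.2 ≤ b 1 ∧
          (∀ i, 2 ≤ i → i ≤ n - 1 → ⟪a i, p.1⟫ ≤ b i) ∧
          ⟪a n, p.1⟫ + ε * p.2 ≤ b n}) ∧
      ⟪a n, y⟫ + ε * (-(b 1 - ⟪a 1, y⟫)) < b n := by
  have key : ∀ s t u v c : ℝ, 0 < s → 0 < t → s + t = 1 → u ≤ c → v ≤ c →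
      s * u + t * v = c → u = c := by
    intro s t u v c hs ht hst hu hv h
    have h2 : t * v ≤ t * c := mul_le_mul_of_nonneg_left hv ht.le
    have h3 : t * c = c - s * c := by
      have : t = 1 - s := by linarith
      rw [this]; ring
    have h4 : s * c ≤ s * u := by linarith
    exact le_antisymm hu (le_of_mul_le_mul_left h4 hs)
  intro ε hε
  have hpos : 0 < ε * (b 1 - ⟪a 1, y⟫) := mul_pos hε (by linarith)
  have hyP : ∀ i, 1 ≤ i → i ≤ n → ⟪a i, y⟫ ≤ b i := by
    have := hy.1
    rw [hP] at this
    exact this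
  have hstrict : ⟪a n, y⟫ + ε * (-(b 1 - ⟪a 1, y⟫)) < b n := by
    rw [mul_neg]; linarith
  refine ⟨⟨⟨?_, ?_, ?_, hstrict.le⟩, ?_⟩, hstrict⟩
  · show ⟪a 1, y⟫ + -(b 1 - ⟪a 1, y⟫) ≤ b 1
    linarith
  · show ⟪a 1, y⟫ - -(b 1 - ⟪a 1, y⟫) ≤ b 1
    linarith
  · intro i hi hi'
    exact hyP i (by omega) (by omega)
  · rintro ⟨p, r⟩ ⟨_, hp2, hp3, _⟩ ⟨q, r'⟩ ⟨_, hq2, hq3, _⟩ ⟨s, t, hs, ht, hst, h⟩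
    simp only [Prod.smul_mk, Prod.mk_add_mk, Prod.mk.injEq, smul_eq_mul] at h
    obtain ⟨h1, h2⟩ := h
    have hin : ∀ i, s * ⟪a i, p⟫ + t * ⟪a i, q⟫ = ⟪a i, y⟫ := by
      intro i
      rw [← h1, inner_add_right, real_inner_smul_right, real_inner_smul_right]
    have hpy : p = y := by
      have : p ∈ ({y} : Set (Euc d)) := by
        rw [← hpinned]
        intro i hi hi' hiy
        exact key s t _ _ _ hs ht hst (hp3 i hi hi') (hq3 i hi hi') ((hin i).trans hiy)
      exact this
    have hr := key s t _ _ _ hs ht hst hp2 hq2 (by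
      have := hin 1
      simp only
      linarith)
    simp only at hr
    subst hpy
    ext1
    · rfl
    · show r = -(b 1 - ⟪a 1, p⟫)
      linarith
end
end
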